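/- For every σ > 0, E > 0, every free parameter β > 0 and every δ ≥ 0, the average-power-constrained capacity is upper-bounded as C(E) ≤ log( β·e^{−δ²/(2σ²)} + √(2π)·σ·Q(δ/σ) ) + (1/2)·Q(δ/σ) + (δ/(2√(2π)σ))·e^{−δ²/(2σ²)} + (δ²/(2σ²))·( 1 − Q((δ + E)/σ) ) + (1/β)·( δ + E + (σ/√(2π))·e^{−δ²/(2σ²)} ) − (1/2)·log(2πeσ²). -/

import Mathlib

open MeasureTheory ProbabilityTheory Real Filter Set
open scoped Classical Topology

/-- Kullback--Leibler divergence (in nats), valued in the extended reals: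
`D(P ∥ R) = ∫ log (dP/dR) dP` if `P ≪ R` and the log-likelihood ratio is
`P`-integrable, and `+∞` otherwise. -/
noncomputable def klDiv {α : Type*} [MeasurableSpace α] (P R : Measure α) : EReal :=
  if P ≪ R ∧ Integrable (llr P R) P then ((∫ x, llr P R x ∂P : ℝ) : EReal) else ⊤

/-- Joint law of `(X, Y)` where `X ~ Q` and `Y = X + Z` with `Z ~ N(0, σ²)`
independent of `X`. -/
noncomputable def jointLaw (σ : ℝ) (Q : Measure ℝ) : Measure (ℝ × ℝ) :=
  (Q.prod (gaussianReal 0 ⟨σ ^ 2, sq_nonneg σ⟩)).map (fun p => (p.1, p.1 + p.2))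

/-- Mutual information `I(X;Y)` in nats: the KL divergence of the joint law of
`(X, Y)` from the product of its marginal laws. -/
noncomputable def mutualInfo (σ : ℝ) (Q : Measure ℝ) : EReal :=
  klDiv (jointLaw σ Q) (((jointLaw σ Q).map Prod.fst).prod ((jointLaw σ Q).map Prod.snd))

/-- Capacity `C(E)` of the channel `Y = X + Z`, `Z ~ N(0, σ²)`, with only an
average-power constraint: `P(X ≥ 0) = 1` and `E[X] ≤ E`. -/
noncomputable def capacityAvg (σ E : ℝ) : EReal :=
  ⨆ Q ∈ {Q : Measure ℝ | IsProbabilityMeasure Q ∧ Q (Set.Ici 0) = 1 ∧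
      ∫⁻ x, ENNReal.ofReal x ∂Q ≤ ENNReal.ofReal E}, mutualInfo σ Q

/-- The Gaussian Q-function `Q(ξ) = ∫_ξ^∞ (1/√(2π)) e^{−t²/2} dt`. -/
noncomputable def Qf (ξ : ℝ) : ℝ := ∫ t in Set.Ioi ξ, (1 / Real.sqrt (2 * π)) * rexp (-t ^ 2 / 2)

noncomputable def vv (σ : ℝ) : NNReal := ⟨σ ^ 2, sq_nonneg σ⟩

lemma coe_vv (σ : ℝ) : (vv σ : ℝ) = σ ^ 2 := rfl

lemma joint_def (σ : ℝ) (Q : Measure ℝ) : jointLaw σ Q =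
    (Q.prod (gaussianReal 0 (vv σ))).map (fun p => (p.1, p.1 + p.2)) := rfl

lemma vv_ne {σ : ℝ} (hσ : 0 < σ) : vv σ ≠ 0 := by
  intro h
  have := congrArg NNReal.toReal h
  have h2 : σ ^ 2 = 0 := this
  nlinarith [pow_pos hσ 2]

lemma meas_w (σ : ℝ) : Measurable (fun p : ℝ × ℝ => gaussianPDF p.1 (vv σ) p.2) :=
  measurable_uncurry_gaussianPDF.comp (f := fun p : ℝ × ℝ => (p.1, vv σ, p.2)) (by fun_prop)

lemma jointLaw_eq {σ : ℝ} (hσ : 0 < σ) (Q : Measure ℝ) [IsProbabilityMeasure Q] :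
    jointLaw σ Q = (Q.prod volume).withDensity (fun p => gaussianPDF p.1 (vv σ) p.2) := by
  have hm : Measurable (fun p : ℝ × ℝ => (p.1, p.1 + p.2)) := by fun_prop
  refine Measure.ext_of_lintegral _ fun h hh => ?_
  rw [joint_def, lintegral_map hh hm, lintegral_withDensity_eq_lintegral_mul _ (meas_w σ) hh,
    lintegral_prod _ (by fun_prop), lintegral_prod _ ((meas_w σ).mul hh).aemeasurable]
  refine lintegral_congr fun x => ?_
  have h1 := gaussianReal_map_const_add (μ := 0) (v := vv σ) x
  have : ∫⁻ y, h (x, x + y) ∂(gaussianReal 0 (vv σ)) = ∫⁻ y, h (x, y) ∂(gaussianReal x (vv σ)) := by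
    rw [← lintegral_map (f := fun y => h (x, y)) (g := fun y => x + y) (by fun_prop) (by fun_prop),
      h1, zero_add]
  refine this.trans ?_
  rw [gaussianReal_of_var_ne_zero _ (vv_ne hσ),
    lintegral_withDensity_eq_lintegral_mul _ (measurable_gaussianPDF _ _) (by fun_prop)]
  rfl

/-- output density -/
noncomputable def ff (σ : ℝ) (Q : Measure ℝ) (y : ℝ) : ENNReal :=
  ∫⁻ x, gaussianPDF x (vv σ) y ∂Q

lemma meas_ff (σ : ℝ) (Q : Measure ℝ) [IsProbabilityMeasure Q] : Measurable (ff σ Q) :=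
  Measurable.lintegral_prod_left' (f := fun p : ℝ × ℝ => gaussianPDF p.1 (vv σ) p.2) (meas_w σ)

lemma ff_pos {σ : ℝ} (hσ : 0 < σ) (Q : Measure ℝ) [IsProbabilityMeasure Q] (y : ℝ) :
    ff σ Q y ≠ 0 := by
  intro h
  have hm : Measurable (fun x => gaussianPDF x (vv σ) y) :=
    (meas_w σ).comp (f := fun x : ℝ => (x, y)) (by fun_prop)
  rw [ff, lintegral_eq_zero_iff hm] at h
  obtain ⟨x, hx⟩ := h.exists
  exact (gaussianPDF_pos x (vv_ne hσ) y).ne' hx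

lemma pdf_le {σ : ℝ} (x y : ℝ) : gaussianPDFReal x (vv σ) y ≤ (√(2 * π * σ ^ 2))⁻¹ := by
  rw [gaussianPDFReal_def, ← coe_vv]
  have : rexp (-(y - x) ^ 2 / (2 * (vv σ : ℝ))) ≤ 1 := by
    rw [Real.exp_le_one_iff]
    have : 0 ≤ (y - x) ^ 2 / (2 * (vv σ : ℝ)) := by positivity
    rw [neg_div]; linarith
  have h2 : 0 ≤ (√(2 * π * (vv σ : ℝ)))⁻¹ := by positivity
  exact mul_le_of_le_one_right h2 this

lemma ff_le (σ : ℝ) (Q : Measure ℝ) [IsProbabilityMeasure Q] (y : ℝ) :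
    ff σ Q y ≤ ENNReal.ofReal (√(2 * π * σ ^ 2))⁻¹ := by
  calc ff σ Q y ≤ ∫⁻ x, ENNReal.ofReal (√(2 * π * σ ^ 2))⁻¹ ∂Q :=
        lintegral_mono fun x => ENNReal.ofReal_le_ofReal (pdf_le x y)
    _ = _ := by simp

lemma ff_ne_top (σ : ℝ) (Q : Measure ℝ) [IsProbabilityMeasure Q] (y : ℝ) : ff σ Q y ≠ ⊤ :=
  ((ff_le σ Q y).trans_lt ENNReal.ofReal_lt_top).ne

lemma map_fst_joint (σ : ℝ) (Q : Measure ℝ) [IsProbabilityMeasure Q] :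
    (jointLaw σ Q).map Prod.fst = Q := by
  rw [joint_def, Measure.map_map measurable_fst (by fun_prop)]
  exact Measure.fst_prod

lemma map_snd_joint {σ : ℝ} (hσ : 0 < σ) (Q : Measure ℝ) [IsProbabilityMeasure Q] :
    (jointLaw σ Q).map Prod.snd = volume.withDensity (ff σ Q) := by
  refine Measure.ext_of_lintegral _ fun h hh => ?_
  have hm : Measurable (fun p : ℝ × ℝ => gaussianPDF p.1 (vv σ) p.2 * h p.2) :=
    (meas_w σ).mul (by fun_prop)
  rw [lintegral_map hh measurable_snd, jointLaw_eq hσ,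
    lintegral_withDensity_eq_lintegral_mul _ (meas_w σ) (by fun_prop),
    lintegral_withDensity_eq_lintegral_mul _ (meas_ff σ Q) hh]
  simp only [Pi.mul_apply]
  rw [lintegral_prod_symm _ hm.aemeasurable]
  refine lintegral_congr fun y => ?_
  simp only []
  rw [lintegral_mul_const, ff]
  exact (meas_w σ).comp (f := fun x : ℝ => (x, y)) (by fun_prop)

lemma joint_wd {σ : ℝ} (hσ : 0 < σ) (Q : Measure ℝ) [IsProbabilityMeasure Q] :
    jointLaw σ Q = (((jointLaw σ Q).map Prod.fst).prod ((jointLaw σ Q).map Prod.snd)).withDensity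
      (fun p => gaussianPDF p.1 (vv σ) p.2 / ff σ Q p.2) := by
  have hf := meas_ff σ Q
  rw [map_fst_joint, map_snd_joint hσ]
  have hg : Measurable (fun p : ℝ × ℝ => gaussianPDF p.1 (vv σ) p.2 / ff σ Q p.2) :=
    (meas_w σ).div (hf.comp measurable_snd)
  have h1 : Q.prod (volume.withDensity (ff σ Q)) =
      (Q.prod volume).withDensity (fun z => ff σ Q z.2) := prod_withDensity_right hf
  rw [h1, ← withDensity_mul _ (f := fun z : ℝ × ℝ => ff σ Q z.2) (hf.comp measurable_snd) hg, jointLaw_eq hσ]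
  congr 1
  funext p
  simp only [Pi.mul_apply]
  exact (ENNReal.mul_div_cancel (ff_pos hσ Q _) (ff_ne_top σ Q _)).symm

lemma joint_ac {σ : ℝ} (hσ : 0 < σ) (Q : Measure ℝ) [IsProbabilityMeasure Q] :
    jointLaw σ Q ≪ ((jointLaw σ Q).map Prod.fst).prod ((jointLaw σ Q).map Prod.snd) := by
  conv_lhs => rw [joint_wd hσ Q]
  exact withDensity_absolutelyContinuous _ _

instance (σ : ℝ) (Q : Measure ℝ) [IsProbabilityMeasure Q] : IsProbabilityMeasure (jointLaw σ Q) := by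
  rw [joint_def]
  exact Measure.isProbabilityMeasure_map (by fun_prop)

lemma llr_joint {σ : ℝ} (hσ : 0 < σ) (Q : Measure ℝ) [IsProbabilityMeasure Q] :
    llr (jointLaw σ Q) (((jointLaw σ Q).map Prod.fst).prod ((jointLaw σ Q).map Prod.snd))
      =ᵐ[jointLaw σ Q]
      fun p => Real.log (gaussianPDFReal p.1 (vv σ) p.2) - Real.log (ff σ Q p.2).toReal := by
  have : IsProbabilityMeasure ((jointLaw σ Q).map Prod.fst) :=
    Measure.isProbabilityMeasure_map (by fun_prop)
  have : IsProbabilityMeasure ((jointLaw σ Q).map Prod.snd) :=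
    Measure.isProbabilityMeasure_map (by fun_prop)
  have hf := meas_ff σ Q
  have h : Measure.rnDeriv (jointLaw σ Q)
      (((jointLaw σ Q).map Prod.fst).prod ((jointLaw σ Q).map Prod.snd)) =ᵐ[
      (((jointLaw σ Q).map Prod.fst).prod ((jointLaw σ Q).map Prod.snd))]
      fun p => gaussianPDF p.1 (vv σ) p.2 / ff σ Q p.2 := by
    have e := joint_wd hσ Q
    have h0 := Measure.rnDeriv_withDensity
      (((jointLaw σ Q).map Prod.fst).prod ((jointLaw σ Q).map Prod.snd))
      (f := fun p => gaussianPDF p.1 (vv σ) p.2 / ff σ Q p.2)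
      ((meas_w σ).div (hf.comp measurable_snd))
    rw [← e] at h0
    exact h0
  have h' := (joint_ac hσ Q).ae_eq h
  filter_upwards [h'] with p hp
  rw [llr, hp]
  rw [ENNReal.toReal_div, Real.log_div, toReal_gaussianPDF]
  · rw [toReal_gaussianPDF]; exact (gaussianPDFReal_pos _ _ _ (vv_ne hσ)).ne'
  · exact (ENNReal.toReal_pos (ff_pos hσ Q _) (ff_ne_top σ Q _)).ne'

noncomputable def ph (t : ℝ) : ℝ := (1 / Real.sqrt (2 * π)) * rexp (-t ^ 2 / 2)

lemma Qf_eq (a : ℝ) : Qf a = ∫ t in Ioi a, ph t := rfl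

lemma ph_pos (t : ℝ) : 0 < ph t := by unfold ph; positivity

lemma ph_pdf : gaussianPDFReal 0 1 = ph := by
  funext t
  simp [gaussianPDFReal, ph]

lemma ph_cont : Continuous ph := by unfold ph; fun_prop

lemma ph_int : Integrable ph := ph_pdf ▸ integrable_gaussianPDFReal 0 1

lemma ph_total : ∫ t, ph t = 1 := ph_pdf ▸ integral_gaussianPDFReal_eq_one 0 one_ne_zero

lemma ph_int1 : Integrable (fun t => t * ph t) := by
  have := (integrable_mul_exp_neg_mul_sq (b := 1/2) (by norm_num)).const_mul (1 / Real.sqrt (2 * π))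
  refine this.congr (ae_of_all _ fun t => ?_)
  simp only [ph]
  rw [show -(1/2) * t^2 = -t^2/2 by ring]; ring

lemma ph_int2 : Integrable (fun t => t ^ 2 * ph t) := by
  have := (integrable_rpow_mul_exp_neg_mul_sq (b := 1/2) (by norm_num) (s := 2) (by norm_num)).const_mul (1 / Real.sqrt (2 * π))
  refine this.congr (ae_of_all _ fun t => ?_)
  simp only [ph]
  rw [show -(1/2) * t^2 = -t^2/2 by ring, Real.rpow_two]; ring

lemma ph_deriv (t : ℝ) : HasDerivAt ph (-(t * ph t)) t := by
  have h : HasDerivAt (fun t : ℝ => -t ^ 2 / 2) (-t) t :=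
    (((hasDerivAt_pow 2 t).neg).div_const 2).congr_deriv (by norm_num; ring)
  exact ((h.exp).const_mul (1 / Real.sqrt (2 * π))).congr_deriv (by simp only [ph]; ring)

lemma nph_deriv (t : ℝ) : HasDerivAt (fun t => - ph t) (t * ph t) t :=
  (ph_deriv t).neg.congr_deriv (by ring)

lemma int_tph (d : ℝ) : ∫ t in Ioi d, t * ph t = ph d := by
  have h0 : Tendsto (fun t => - ph t) atTop (𝓝 0) :=
    tendsto_zero_of_hasDerivAt_of_integrableOn_Ioi (a := 0) (f' := fun t => t * ph t)
      (fun x _ => nph_deriv x) ph_int1.integrableOn ph_int.neg.integrableOn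
  have := integral_Ioi_of_hasDerivAt_of_tendsto' (a := d) (f := fun t => - ph t)
    (f' := fun t => t * ph t) (fun x _ => nph_deriv x) ph_int1.integrableOn h0
  rw [this]; ring

lemma tph_deriv (x : ℝ) : HasDerivAt (fun t => - (t * ph t)) (x ^ 2 * ph x - ph x) x :=
  ((hasDerivAt_id x).mul (ph_deriv x)).neg.congr_deriv (by simp only [id]; ring)

lemma int_t2ph (d : ℝ) : ∫ t in Ioi d, t ^ 2 * ph t = Qf d + d * ph d := by
  have hi := ph_int2.sub ph_int
  have h0 : Tendsto (fun t => - (t * ph t)) atTop (𝓝 0) :=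
    tendsto_zero_of_hasDerivAt_of_integrableOn_Ioi (a := 0)
      (fun x _ => tph_deriv x) hi.integrableOn ph_int1.neg.integrableOn
  have := integral_Ioi_of_hasDerivAt_of_tendsto' (a := d)
    (fun x _ => tph_deriv x) hi.integrableOn h0
  rw [integral_sub ph_int2.integrableOn ph_int.integrableOn, ← Qf_eq] at this
  linarith

lemma gauss_eq (σ : ℝ) : gaussianReal 0 (vv σ) = (gaussianReal 0 1).map (fun t => (-σ) * t) := by
  have := gaussianReal_map_const_mul (μ := 0) (v := 1) (-σ)
  refine Eq.trans ?_ this.symm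
  congr 1
  · simp
  · ext; simp [coe_vv]

lemma gauss_std (h : ℝ → ℝ) : ∫ t, h t ∂(gaussianReal 0 1) = ∫ t, ph t * h t := by
  rw [integral_gaussianReal_eq_integral_smul one_ne_zero, ph_pdf]; rfl

lemma gauss_int {σ : ℝ} {h : ℝ → ℝ} (hh : Measurable h) :
    ∫ z, h z ∂(gaussianReal 0 (vv σ)) = ∫ t, ph t * h (-σ * t) := by
  rw [gauss_eq, integral_map (by fun_prop) hh.aestronglyMeasurable, gauss_std]

lemma memLp_g (σ : ℝ) : MemLp id 2 (gaussianReal 0 (vv σ)) := memLp_id_gaussianReal' 2 (by simp)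

lemma g_int1 (σ : ℝ) : Integrable (fun z => z) (gaussianReal 0 (vv σ)) :=
  (memLp_g σ).integrable (by norm_num)

lemma g_int2 (σ : ℝ) : Integrable (fun z => z ^ 2) (gaussianReal 0 (vv σ)) :=
  (memLp_g σ).integrable_sq

lemma g_sq (σ : ℝ) : ∫ z, z ^ 2 ∂(gaussianReal 0 (vv σ)) = σ ^ 2 := by
  have h := variance_fun_id_gaussianReal (μ := 0) (v := vv σ)
  rw [variance_eq_integral (by fun_prop), integral_id_gaussianReal] at h
  simpa [coe_vv] using h

/-- indicator part -/
noncomputable def hA (σ β δ : ℝ) : ℝ → ℝ :=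
  (Iio (-δ)).indicator (fun z => z ^ 2 / (2 * σ ^ 2) - z / β)

lemma hA_int (σ β δ : ℝ) : Integrable (hA σ β δ) (gaussianReal 0 (vv σ)) :=
  (((g_int2 σ).div_const _).sub ((g_int1 σ).div_const _)).indicator measurableSet_Iio

lemma hA_meas (σ β δ : ℝ) : Measurable (hA σ β δ) :=
  Measurable.indicator (by fun_prop) measurableSet_Iio

lemma hA_eq {σ : ℝ} (hσ : 0 < σ) (β δ : ℝ) : ∫ z, hA σ β δ z ∂(gaussianReal 0 (vv σ)) =
    1 / 2 * Qf (δ / σ) + 1 / 2 * (δ / σ) * ph (δ / σ) + σ / β * ph (δ / σ) := by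
  rw [gauss_int (hA_meas σ β δ)]
  have : (fun t => ph t * hA σ β δ (-σ * t)) =
      (Ioi (δ / σ)).indicator (fun t => 1 / 2 * (t ^ 2 * ph t) + σ / β * (t * ph t)) := by
    funext t
    have e : -σ * t < -δ ↔ δ / σ < t := by
      rw [div_lt_iff₀ hσ]; constructor <;> intro h <;> nlinarith
    by_cases ht : δ / σ < t
    · rw [hA, indicator_of_mem (by simpa using e.2 ht), indicator_of_mem (by simpa using ht)]
      field_simp; ring
    · rw [hA, indicator_of_notMem (by simpa using (not_congr e).2 ht),
        indicator_of_notMem (by simpa using ht), mul_zero]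
  rw [this, integral_indicator measurableSet_Ioi,
    integral_add (ph_int2.const_mul _).integrableOn (ph_int1.const_mul _).integrableOn,
    integral_const_mul, integral_const_mul, int_tph, int_t2ph]
  ring

lemma Qf_compl (a : ℝ) : ∫ t in Iic a, ph t = 1 - Qf a := by
  have := integral_add_compl (s := Iic a) measurableSet_Iic ph_int
  rw [compl_Iic, ph_total, ← Qf_eq] at this
  linarith

lemma B_eq {σ : ℝ} (hσ : 0 < σ) (a : ℝ) :
    ∫ z, (Ici (-a)).indicator (fun _ => (1 : ℝ)) z ∂(gaussianReal 0 (vv σ)) = 1 - Qf (a / σ) := by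
  rw [gauss_int (Measurable.indicator (by fun_prop) measurableSet_Ici)]
  have : (fun t => ph t * (Ici (-a)).indicator (fun _ => (1 : ℝ)) (-σ * t)) =
      (Iic (a / σ)).indicator ph := by
    funext t
    have e : -a ≤ -σ * t ↔ t ≤ a / σ := by
      rw [le_div_iff₀ hσ]; constructor <;> intro h <;> nlinarith
    by_cases ht : t ≤ a / σ
    · rw [indicator_of_mem (by simpa using e.2 ht), indicator_of_mem (by simpa using ht), mul_one]
    · rw [indicator_of_notMem (by simpa using (not_congr e).2 ht),
        indicator_of_notMem (by simpa using ht), mul_zero]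
  rw [this, integral_indicator measurableSet_Iic, Qf_compl]

lemma ph_anti {s t : ℝ} (hs : 0 ≤ s) (h : s ≤ t) : ph t ≤ ph s := by
  unfold ph
  have : -t^2/2 ≤ -s^2/2 := by nlinarith
  have := Real.exp_le_exp.2 this
  gcongr

lemma Qf_tangent {a b : ℝ} (ha : 0 ≤ a) (hb : 0 ≤ b) : 1 - Qf a ≤ 1 - Qf b + ph b * (a - b) := by
  have hi : ∀ u v : ℝ, IntervalIntegrable ph volume u v := fun u v => ph_cont.intervalIntegrable u v
  rcases le_total a b with h | h
  · have e := intervalIntegral.integral_Ioi_sub_Ioi (a := a) (b := b) ph_int.integrableOn h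
    rw [← Qf_eq, ← Qf_eq] at e
    have : ∫ t in a..b, ph b ≤ ∫ t in a..b, ph t :=
      intervalIntegral.integral_mono_on h (by simp) (hi _ _)
        fun x hx => ph_anti (ha.trans hx.1) hx.2
    rw [intervalIntegral.integral_const, smul_eq_mul] at this
    linarith
  · have e := intervalIntegral.integral_Ioi_sub_Ioi (a := b) (b := a) ph_int.integrableOn h
    rw [← Qf_eq, ← Qf_eq] at e
    have : ∫ t in b..a, ph t ≤ ∫ t in b..a, ph b :=
      intervalIntegral.integral_mono_on h (hi _ _) (by simp)
        fun x hx => ph_anti hb hx.1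
    rw [intervalIntegral.integral_const, smul_eq_mul] at this
    linarith


noncomputable def ps (σ β δ y : ℝ) : ℝ :=
  if y ≤ -δ then y ^ 2 / (2 * σ ^ 2) else δ ^ 2 / (2 * σ ^ 2) + (y + δ) / β

noncomputable def KK (σ β δ : ℝ) : ℝ :=
  β * rexp (-δ ^ 2 / (2 * σ ^ 2)) + Real.sqrt (2 * π) * σ * Qf (δ / σ)

lemma Qf_nonneg (a : ℝ) : 0 ≤ Qf a := setIntegral_nonneg measurableSet_Ioi fun t _ => (ph_pos t).le

lemma KK_pos {σ β δ : ℝ} (hσ : 0 < σ) (hβ : 0 < β) : 0 < KK σ β δ := by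
  have := Qf_nonneg (δ / σ)
  unfold KK; positivity

lemma ps_meas (σ β δ : ℝ) : Measurable (ps σ β δ) :=
  Measurable.ite measurableSet_Iic (by fun_prop) (by fun_prop)

lemma ph_scale {σ : ℝ} (hσ : 0 < σ) (y : ℝ) :
    rexp (-(y ^ 2 / (2 * σ ^ 2))) = √(2 * π) * ph (σ⁻¹ * y) := by
  unfold ph
  have : √(2 * π) ≠ 0 := by positivity
  rw [show -(y ^ 2 / (2 * σ ^ 2)) = -(σ⁻¹ * y) ^ 2 / 2 by field_simp]
  field_simp

lemma exp_ps_left {σ : ℝ} (hσ : 0 < σ) (δ : ℝ) :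
    IntegrableOn (fun y => rexp (-(y ^ 2 / (2 * σ ^ 2)))) (Iic (-δ)) ∧
    ∫ y in Iic (-δ), rexp (-(y ^ 2 / (2 * σ ^ 2))) = √(2 * π) * σ * Qf (δ / σ) := by
  constructor
  · have : Integrable (fun y => √(2 * π) * ph (σ⁻¹ * y)) :=
      (ph_int.comp_mul_left' (inv_ne_zero hσ.ne')).const_mul _
    exact (this.congr (ae_of_all _ fun y => (ph_scale hσ y).symm)).integrableOn
  · have h := integral_comp_neg_Iic (-δ) (fun y => rexp (-(y ^ 2 / (2 * σ ^ 2))))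
    simp only [neg_sq, neg_neg] at h
    rw [h]
    simp_rw [ph_scale hσ]
    rw [integral_const_mul, integral_comp_mul_left_Ioi ph δ (inv_pos.2 hσ), ← Qf_eq, inv_inv,
      smul_eq_mul, div_eq_inv_mul]
    ring

lemma exp_ps_right {β : ℝ} (hβ : 0 < β) (σ δ : ℝ) :
    IntegrableOn (fun y => rexp (-(δ ^ 2 / (2 * σ ^ 2) + (y + δ) / β))) (Ioi (-δ)) ∧
    ∫ y in Ioi (-δ), rexp (-(δ ^ 2 / (2 * σ ^ 2) + (y + δ) / β)) =
      β * rexp (-δ ^ 2 / (2 * σ ^ 2)) := by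
  have hb : -β⁻¹ < 0 := by simpa using hβ
  have e : (fun y => rexp (-(δ ^ 2 / (2 * σ ^ 2) + (y + δ) / β))) =
      fun y => (rexp (-δ ^ 2 / (2 * σ ^ 2)) * rexp (-δ / β)) * rexp (-β⁻¹ * y) := by
    funext y
    rw [← Real.exp_add, ← Real.exp_add]
    congr 1
    field_simp; ring
  rw [e]
  constructor
  · exact (integrableOn_exp_mul_Ioi hb _).const_mul _
  · rw [integral_const_mul, integral_exp_mul_Ioi hb]
    have : rexp (-δ / β) * rexp (-β⁻¹ * -δ) = 1 := by
      rw [← Real.exp_add, Real.exp_eq_one_iff]; field_simp; ring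
    rw [neg_div_neg_eq, div_inv_eq_mul]
    linear_combination β * rexp (-δ ^ 2 / (2 * σ ^ 2)) * this

lemma exp_ps {σ β : ℝ} (hσ : 0 < σ) (hβ : 0 < β) (δ : ℝ) :
    ∫⁻ y, ENNReal.ofReal (rexp (-ps σ β δ y)) = ENNReal.ofReal (KK σ β δ) := by
  have h1 : ∫⁻ y in Iic (-δ), ENNReal.ofReal (rexp (-ps σ β δ y)) =
      ENNReal.ofReal (√(2 * π) * σ * Qf (δ / σ)) := by
    rw [← (exp_ps_left hσ δ).2, ofReal_integral_eq_lintegral_ofReal (exp_ps_left hσ δ).1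
      (ae_of_all _ fun y => (Real.exp_pos _).le)]
    refine setLIntegral_congr_fun measurableSet_Iic fun y hy => ?_
    simp only [ps]; rw [if_pos (mem_Iic.1 hy)]
  have h2 : ∫⁻ y in Ioi (-δ), ENNReal.ofReal (rexp (-ps σ β δ y)) =
      ENNReal.ofReal (β * rexp (-δ ^ 2 / (2 * σ ^ 2))) := by
    rw [← (exp_ps_right hβ σ δ).2, ofReal_integral_eq_lintegral_ofReal (exp_ps_right hβ σ δ).1
      (ae_of_all _ fun y => (Real.exp_pos _).le)]
    refine setLIntegral_congr_fun measurableSet_Ioi fun y hy => ?_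
    simp only [ps]; rw [if_neg (not_le.2 hy)]
  have := Qf_nonneg (δ / σ)
  rw [← lintegral_add_compl _ (measurableSet_Iic (a := -δ)), compl_Iic, h1, h2, KK,
    ← ENNReal.ofReal_add (by positivity) (by positivity), add_comm]

noncomputable def rd (σ β δ y : ℝ) : ℝ := rexp (-ps σ β δ y) / KK σ β δ

lemma rd_meas (σ β δ : ℝ) : Measurable (rd σ β δ) := by
  have := ps_meas σ β δ
  unfold rd; fun_prop

lemma rd_int {σ β : ℝ} (hσ : 0 < σ) (hβ : 0 < β) (δ : ℝ) :
    ∫⁻ y, ENNReal.ofReal (rd σ β δ y) = 1 := by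
  have hK := KK_pos (δ := δ) hσ hβ
  have hm := ps_meas σ β δ
  simp_rw [rd, ENNReal.ofReal_div_of_pos hK, div_eq_mul_inv]
  rw [lintegral_mul_const _ (by fun_prop), exp_ps hσ hβ]
  exact ENNReal.mul_inv_cancel (by simpa using hK) ENNReal.ofReal_ne_top

lemma ps_le {σ β δ x z : ℝ} (hσ : 0 < σ) (hβ : 0 < β) (hδ : 0 ≤ δ) (hx : 0 ≤ x) :
    ps σ β δ (x + z) ≤ hA σ β δ z +
      δ ^ 2 / (2 * σ ^ 2) * (Ici (-(x + δ))).indicator (fun _ => (1 : ℝ)) z + (x + z + δ) / β := by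
  have hA0 : 0 ≤ hA σ β δ z := by
    refine indicator_nonneg (fun z hz => ?_) z
    have : 0 ≤ -z := by have : z < -δ := hz; linarith
    have : 0 ≤ (-z) / β := by positivity
    have : 0 ≤ z ^ 2 / (2 * σ ^ 2) := by positivity
    rw [neg_div] at *; linarith
  have hI : 0 ≤ δ ^ 2 / (2 * σ ^ 2) * (Ici (-(x + δ))).indicator (fun _ => (1 : ℝ)) z :=
    mul_nonneg (by positivity) (indicator_nonneg (fun _ _ => zero_le_one) _)
  unfold ps
  split_ifs with h
  · by_cases hz : z < -δ
    · rw [hA, indicator_of_mem (by exact hz)]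
      have h1 : (x + z) ^ 2 / (2 * σ ^ 2) ≤ z ^ 2 / (2 * σ ^ 2) := by
        gcongr 1; nlinarith
      have h2 : 0 ≤ (x + δ) / β := by positivity
      have h3 : (x + z + δ) / β = (x + δ) / β + z / β := by ring
      linarith
    · have hx0 : x = 0 := by linarith
      have hz0 : z = -δ := by linarith
      subst hx0 hz0
      rw [indicator_of_mem (by simp)]
      simp only [zero_add, neg_sq, neg_add_cancel, zero_div]
      linarith
  · have hm : z ∈ Ici (-(x + δ)) := by simp only [mem_Ici]; linarith
    rw [indicator_of_mem hm]
    linarith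

noncomputable def TT (σ β δ : ℝ) (Q : Measure ℝ) (y : ℝ) : ENNReal :=
  ENNReal.ofReal (rd σ β δ y) / ff σ Q y

lemma TT_meas (σ β δ : ℝ) (Q : Measure ℝ) [IsProbabilityMeasure Q] : Measurable (TT σ β δ Q) :=
  (rd_meas σ β δ).ennreal_ofReal.div (meas_ff σ Q)

lemma TT_lint {σ β : ℝ} (hσ : 0 < σ) (hβ : 0 < β) (δ : ℝ) (Q : Measure ℝ)
    [IsProbabilityMeasure Q] :
    ∫⁻ p, TT σ β δ Q (p.1 + p.2) ∂(Q.prod (gaussianReal 0 (vv σ))) = 1 := by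
  have hT := TT_meas σ β δ Q
  have h1 : ∫⁻ y, TT σ β δ Q y ∂((jointLaw σ Q).map Prod.snd) = 1 := by
    rw [map_snd_joint hσ, lintegral_withDensity_eq_lintegral_mul _ (meas_ff σ Q) hT,
      ← rd_int hσ hβ δ]
    refine lintegral_congr fun y => ?_
    exact ENNReal.mul_div_cancel (ff_pos hσ Q _) (ff_ne_top σ Q _)
  rw [lintegral_map hT measurable_snd, joint_def, lintegral_map (by fun_prop) (by fun_prop)] at h1
  exact h1

lemma log_w {σ : ℝ} (hσ : 0 < σ) (x z : ℝ) : Real.log (gaussianPDFReal x (vv σ) (x + z)) =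
    Real.log (√(2 * π * σ ^ 2))⁻¹ - z ^ 2 / (2 * σ ^ 2) := by
  rw [gaussianPDFReal_def]
  simp only [coe_vv, add_sub_cancel_left]
  rw [Real.log_mul (by positivity) (Real.exp_pos _).ne', Real.log_exp]
  ring

lemma Qbound {σ E β δ : ℝ} (hσ : 0 < σ) (hE : 0 < E)
    (hβ : 0 < β) (hδ : 0 ≤ δ) (Q : Measure ℝ) [IsProbabilityMeasure Q]
    (hx0 : ∀ᵐ x ∂Q, 0 ≤ x) (hxi : Integrable (fun x => x) Q) (hxE : ∫ x, x ∂Q ≤ E) :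
    mutualInfo σ Q ≤ ((Real.log (KK σ β δ) + (1 / 2 * Qf (δ / σ) + 1 / 2 * (δ / σ) * ph (δ / σ)
      + σ / β * ph (δ / σ)) + δ ^ 2 / (2 * σ ^ 2) * (1 - Qf ((δ + E) / σ)) + (E + δ) / β
      + Real.log (√(2 * π * σ ^ 2))⁻¹ - 1 / 2 : ℝ) : EReal) := by
  set G := gaussianReal 0 (vv σ) with hG
  set ν := Q.prod G with hν
  set c0 := Real.log (√(2 * π * σ ^ 2))⁻¹ with hc0
  have hK := KK_pos (δ := δ) hσ hβ
  have hfm := meas_ff σ Q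
  have hTm := TT_meas σ β δ Q
  set J : ℝ × ℝ → ℝ := fun p =>
    Real.log (gaussianPDFReal p.1 (vv σ) p.2) - Real.log (ff σ Q p.2).toReal with hJ
  have hJm : Measurable J := by
    have : Measurable (fun p : ℝ × ℝ => gaussianPDFReal p.1 (vv σ) p.2) :=
      measurable_uncurry_gaussianPDFReal.comp (f := fun p : ℝ × ℝ => (p.1, vv σ, p.2)) (by fun_prop)
    fun_prop
  have hmap : Measurable (fun p : ℝ × ℝ => (p.1, p.1 + p.2)) := by fun_prop
  set I : ℝ × ℝ → ℝ := fun p => (Ici (-(p.1 + δ))).indicator (fun _ => (1 : ℝ)) p.2 with hI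
  have hIm : Measurable I := by
    have hs : MeasurableSet {p : ℝ × ℝ | -(p.1 + δ) ≤ p.2} :=
      measurableSet_le (by fun_prop) (by fun_prop)
    exact (measurable_const (a := (1 : ℝ))).indicator hs
  have hIi : Integrable I ν := by
    refine Integrable.of_bound hIm.aestronglyMeasurable 1 (ae_of_all _ fun p => ?_)
    simp only [hI, indicator]; split_ifs <;> simp
  have hIint : ∫ p, I p ∂ν ≤ 1 - Qf ((δ + E) / σ) := by
    have e1 : ∀ x, ∫ z, I (x, z) ∂G = 1 - Qf ((x + δ) / σ) := fun x => B_eq hσ (x + δ)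
    have hi := hIi.integral_prod_left
    rw [integral_prod _ hIi]
    simp_rw [e1] at hi ⊢
    calc ∫ x, (1 - Qf ((x + δ) / σ)) ∂Q
        ≤ ∫ x, (1 - Qf ((δ + E) / σ) + ph ((δ + E) / σ) / σ * (x - E)) ∂Q := by
          refine integral_mono_ae hi ?_ ?_
          · exact (integrable_const _).add ((hxi.sub (integrable_const _)).const_mul _)
          · filter_upwards [hx0] with x hx
            have := Qf_tangent (a := (x + δ) / σ) (b := (δ + E) / σ) (by positivity) (by positivity)
            refine this.trans (le_of_eq ?_)
            field_simp; ring
      _ = 1 - Qf ((δ + E) / σ) + ph ((δ + E) / σ) / σ * (∫ x, x ∂Q - E) := by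
          have hs : Integrable (fun x => x - E) Q := hxi.sub (integrable_const _)
          rw [integral_add (integrable_const _) (hs.const_mul _),
            integral_const_mul, integral_sub hxi (integrable_const _)]
          simp
      _ ≤ _ := by
          have : 0 ≤ ph ((δ + E) / σ) / σ := div_nonneg (ph_pos _).le hσ.le
          nlinarith
  set T : ℝ × ℝ → ℝ := fun p => (TT σ β δ Q (p.1 + p.2)).toReal with hT
  have hTl := TT_lint hσ hβ δ Q
  have hTi : Integrable T ν :=
    integrable_toReal_of_lintegral_ne_top (by fun_prop) (by rw [hTl]; simp)
  have hTint : ∫ p, T p ∂ν = 1 := by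
    rw [integral_toReal (by fun_prop), hTl]; · simp
    exact ae_lt_top (by fun_prop) (by rw [hTl]; simp)
  -- pieces
  have hz2 : Integrable (fun p : ℝ × ℝ => p.2 ^ 2 / (2 * σ ^ 2)) ν :=
    ((g_int2 σ).div_const (2 * σ ^ 2)).comp_snd Q
  have hz2i : ∫ p : ℝ × ℝ, p.2 ^ 2 / (2 * σ ^ 2) ∂ν = 1 / 2 := by
    rw [integral_fun_snd (fun z => z ^ 2 / (2 * σ ^ 2)), integral_div, g_sq]
    simp; field_simp
  have hA1 : Integrable (fun p : ℝ × ℝ => hA σ β δ p.2) ν := (hA_int σ β δ).comp_snd Q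
  have hA2 : ∫ p : ℝ × ℝ, hA σ β δ p.2 ∂ν = 1 / 2 * Qf (δ / σ) + 1 / 2 * (δ / σ) * ph (δ / σ)
      + σ / β * ph (δ / σ) := by
    rw [integral_fun_snd (hA σ β δ), hA_eq hσ]; simp
  have hxν : Integrable (fun p : ℝ × ℝ => p.1) ν := hxi.comp_fst G
  have hzν : Integrable (fun p : ℝ × ℝ => p.2) ν := (g_int1 σ).comp_snd Q
  have hxz : Integrable (fun p : ℝ × ℝ => (p.1 + p.2 + δ) / β) ν :=
    ((hxν.add hzν).add (integrable_const δ)).div_const β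
  have hxzi : ∫ p : ℝ × ℝ, (p.1 + p.2 + δ) / β ∂ν ≤ (E + δ) / β := by
    have hs : Integrable (fun p : ℝ × ℝ => p.1 + p.2) ν := hxν.add hzν
    rw [integral_div, integral_add hs (integrable_const δ), integral_add hxν hzν,
      integral_fun_fst (fun x => x), integral_fun_snd (fun x => x), hG, integral_id_gaussianReal]
    simp only [integral_const, probReal_univ, smul_eq_mul, one_mul, mul_zero, add_zero]
    gcongr
  set U : ℝ × ℝ → ℝ := fun p => (c0 - 1 + Real.log (KK σ β δ)) - p.2 ^ 2 / (2 * σ ^ 2) + T p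
    + hA σ β δ p.2 + δ ^ 2 / (2 * σ ^ 2) * I p + (p.1 + p.2 + δ) / β with hU
  have i1 : Integrable (fun p : ℝ × ℝ => (c0 - 1 + Real.log (KK σ β δ)) - p.2 ^ 2 / (2 * σ ^ 2)) ν :=
    (integrable_const _).sub hz2
  have i2 := i1.add hTi
  have i3 := i2.add hA1
  have i4 := i3.add (hIi.const_mul (δ ^ 2 / (2 * σ ^ 2)))
  have i5 : Integrable U ν := i4.add hxz
  have hUint : ∫ p, U p ∂ν = (c0 - 1 + Real.log (KK σ β δ)) - 1 / 2 + 1 +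
      (1 / 2 * Qf (δ / σ) + 1 / 2 * (δ / σ) * ph (δ / σ) + σ / β * ph (δ / σ)) +
      δ ^ 2 / (2 * σ ^ 2) * ∫ p, I p ∂ν + ∫ p : ℝ × ℝ, (p.1 + p.2 + δ) / β ∂ν := by
    have e5 := integral_add i4 hxz
    have e4 := integral_add i3 (hIi.const_mul (δ ^ 2 / (2 * σ ^ 2)))
    have e3 := integral_add i2 hA1
    have e2 := integral_add i1 hTi
    have e1 := integral_sub (integrable_const (μ := ν) (c0 - 1 + Real.log (KK σ β δ))) hz2
    simp only [Pi.add_apply] at e1 e2 e3 e4 e5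
    rw [integral_const_mul] at e4
    simp only [hU]
    rw [e5, e4, e3, e2, e1, hA2, hTint, hz2i]
    simp
  have hx0ν : ∀ᵐ p ∂ν, 0 ≤ p.1 := Measure.quasiMeasurePreserving_fst.ae hx0
  have hfp : ∀ y, 0 < (ff σ Q y).toReal :=
    fun y => ENNReal.toReal_pos (ff_pos hσ Q y) (ff_ne_top σ Q y)
  have hJU : ∀ᵐ p ∂ν, J (p.1, p.1 + p.2) ≤ U p := by
    filter_upwards [hx0ν] with p hp
    have h1 := ps_le (z := p.2) hσ hβ hδ hp
    set y := p.1 + p.2 with hy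
    have hr : 0 < rd σ β δ y := div_pos (Real.exp_pos _) hK
    have hTy : T p = rd σ β δ y / (ff σ Q y).toReal := by
      simp only [hT, TT]
      rw [ENNReal.toReal_div, ENNReal.toReal_ofReal hr.le]
    have h2 := Real.log_le_sub_one_of_pos (div_pos hr (hfp y))
    rw [Real.log_div hr.ne' (hfp y).ne', ← hTy] at h2
    have h3 : Real.log (rd σ β δ y) = -ps σ β δ y - Real.log (KK σ β δ) := by
      rw [rd, Real.log_div (Real.exp_pos _).ne' hK.ne', Real.log_exp]
    have h4 := log_w hσ p.1 p.2
    simp only [hJ, hU, hI]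
    rw [h4]
    linarith
  have hJL : ∀ᵐ p ∂ν, -(p.2 ^ 2 / (2 * σ ^ 2)) ≤ J (p.1, p.1 + p.2) := by
    refine ae_of_all _ fun p => ?_
    have h4 := log_w hσ p.1 p.2
    have h5 : Real.log (ff σ Q (p.1 + p.2)).toReal ≤ c0 := by
      refine Real.log_le_log (hfp _) ?_
      exact ENNReal.toReal_le_of_le_ofReal (by positivity) (ff_le σ Q _)
    simp only [hJ]
    rw [h4]
    linarith
  have hJi : Integrable (fun p : ℝ × ℝ => J (p.1, p.1 + p.2)) ν :=
    integrable_of_le_of_le (hJm.comp hmap).aestronglyMeasurable hJL hJU hz2.neg i5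
  have hJP : Integrable J (jointLaw σ Q) := by
    rw [joint_def]
    exact (integrable_map_measure hJm.aestronglyMeasurable hmap.aemeasurable).2 hJi
  have hl := llr_joint hσ Q
  rw [mutualInfo, klDiv, if_pos ⟨joint_ac hσ Q, hJP.congr hl.symm⟩, EReal.coe_le_coe_iff,
    integral_congr_ae hl]
  calc ∫ p, J p ∂(jointLaw σ Q) = ∫ p : ℝ × ℝ, J (p.1, p.1 + p.2) ∂ν := by
        rw [joint_def, integral_map hmap.aemeasurable hJm.aestronglyMeasurable]
    _ ≤ ∫ p, U p ∂ν := integral_mono_ae hJi i5 hJU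
    _ ≤ _ := by
        rw [hUint]
        have : δ ^ 2 / (2 * σ ^ 2) * ∫ p, I p ∂ν ≤ δ ^ 2 / (2 * σ ^ 2) * (1 - Qf ((δ + E) / σ)) :=
          mul_le_mul_of_nonneg_left hIint (by positivity)
        linarith

/-- Duality-based upper bound on the average-power-constrained capacity, with
free parameters `β > 0` and `δ ≥ 0`. -/
theorem capacityAvg_upper_bound_high (σ E β δ : ℝ) (hσ : 0 < σ) (hE : 0 < E)
    (hβ : 0 < β) (hδ : 0 ≤ δ) :
    capacityAvg σ E ≤
      ((Real.log (β * rexp (-δ ^ 2 / (2 * σ ^ 2)) + Real.sqrt (2 * π) * σ * Qf (δ / σ))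
        + 1 / 2 * Qf (δ / σ)
        + δ / (2 * Real.sqrt (2 * π) * σ) * rexp (-δ ^ 2 / (2 * σ ^ 2))
        + δ ^ 2 / (2 * σ ^ 2) * (1 - Qf ((δ + E) / σ))
        + 1 / β * (δ + E + σ / Real.sqrt (2 * π) * rexp (-δ ^ 2 / (2 * σ ^ 2)))
        - 1 / 2 * Real.log (2 * π * rexp 1 * σ ^ 2) : ℝ) : EReal) := by
  refine iSup₂_le fun Q hQ => ?_
  obtain ⟨hP, h0, hm⟩ := hQ
  have hx0 : ∀ᵐ x ∂Q, 0 ≤ x := by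
    have := (prob_compl_eq_zero_iff (μ := Q) (measurableSet_Ici (a := (0 : ℝ)))).2 h0
    exact this
  have hxi : Integrable (fun x => x) Q := by
    refine ⟨by fun_prop, ?_⟩
    rw [hasFiniteIntegral_iff_ofReal hx0]
    exact hm.trans_lt ENNReal.ofReal_lt_top
  have hxE : ∫ x, x ∂Q ≤ E := by
    rw [integral_eq_lintegral_of_nonneg_ae hx0 (by fun_prop)]
    exact ENNReal.toReal_le_of_le_ofReal hE.le hm
  refine (Qbound hσ hE hβ hδ Q hx0 hxi hxE).trans (EReal.coe_le_coe_iff.2 (le_of_eq ?_))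
  have hs : √(2 * π) ≠ 0 := by positivity
  have e1 : Real.log (√(2 * π * σ ^ 2))⁻¹ = - (1 / 2 * Real.log (2 * π * σ ^ 2)) := by
    rw [Real.log_inv, Real.log_sqrt (by positivity)]; ring
  have e2 : Real.log (2 * π * rexp 1 * σ ^ 2) = Real.log (2 * π * σ ^ 2) + 1 := by
    rw [show 2 * π * rexp 1 * σ ^ 2 = (2 * π * σ ^ 2) * rexp 1 by ring,
      Real.log_mul (by positivity) (Real.exp_pos _).ne', Real.log_exp]
  have e3 : ph (δ / σ) = 1 / √(2 * π) * rexp (-δ ^ 2 / (2 * σ ^ 2)) := by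
    rw [ph, show -(δ / σ) ^ 2 / 2 = -δ ^ 2 / (2 * σ ^ 2) by field_simp]
  rw [e1, e2, e3, KK]
  field_simp
  ring
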